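/- arXiv:0809.3539 — 2 statements merged into one kernel-verified Lean document; each statement's English description precedes it below -/
import Mathlib

section
/- Let q be an odd prime power, d ≥ 2, and E ⊆ F_q^d. Then f(E) ≤ (q − 1) · |E| · ((q^{d−1} + q^{(d−1)/2})|E|/q^d + 2q^{(d−1)/2})². -/
open Finset

/-- `degE E p r` is the number of points of `E` at distance `r` from `p`, where the
distance in `F_q^d` is `‖p − y‖ = ∑ i, (p i − y i)²`. -/
def degE {F : Type} [Field F] [DecidableEq F] {d : ℕ} (E : Finset (Fin d → F))
    (p : Fin d → F) (r : F) : ℕ :=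
  (E.filter (fun y => ∑ i, (p i - y i) ^ 2 = r)).card

/-- `fE E = ∑_{r ∈ F_q*} ∑_{p ∈ E} deg_E(p,r)²` is the sum of the squared multiplicities
of the nonzero distances determined by `E`. -/
def fE {F : Type} [Field F] [Fintype F] [DecidableEq F] {d : ℕ}
    (E : Finset (Fin d → F)) : ℕ :=
  ∑ r ∈ Finset.univ.filter (fun r : F => r ≠ 0), ∑ p ∈ E, (degE E p r) ^ 2

/-- Every fibre of a nonzero linear form on `F^d` has `q^(d-1)` points. -/
lemma card_linear_form_eq {F : Type} [Field F] [Fintype F] [DecidableEq F] {d : ℕ}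
    (v : Fin d → F) (hv : v ≠ 0) (c : F) :
    Fintype.card F * #{p : Fin d → F | ∑ i, p i * v i = c} = Fintype.card F ^ d := by
  let φ : (Fin d → F) →+ F :=
    { toFun := fun p => ∑ i, p i * v i
      map_zero' := by simp
      map_add' := fun a b => by simp [add_mul, sum_add_distrib] }
  have hφ : Function.Surjective φ := by
    obtain ⟨j, hj⟩ := Function.ne_iff.mp hv
    intro a
    refine ⟨Pi.single j (a / v j), ?_⟩
    change ∑ i, (Pi.single j (a / v j) : Fin d → F) i * v i = a
    rw [Finset.sum_eq_single j]
    · simpa using div_mul_cancel₀ a hj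
    · intro i _ hi
      simp [hi]
    · simp
  have hfib : ∀ b : F, #{p : Fin d → F | φ p = b} = #{p : Fin d → F | φ p = c} := fun b =>
    AddMonoidHom.card_fiber_eq_of_mem_range φ (hφ b) (hφ c)
  have hsum := card_eq_sum_card_fiberwise (f := φ) (s := (univ : Finset (Fin d → F)))
    (t := (univ : Finset F)) (by simp)
  simp only [hfib, sum_const, card_univ, smul_eq_mul, Fintype.card_fun, Fintype.card_fin] at hsum
  exact hsum.symm

/-- The points equidistant from two distinct points form a hyperplane. -/
lemma card_equidistant {F : Type} [Field F] [Fintype F] [DecidableEq F]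
    (h2 : (2 : F) ≠ 0) {d : ℕ} {y z : Fin d → F} (hyz : y ≠ z) :
    Fintype.card F * #{p : Fin d → F | ∑ i, (p i - z i) ^ 2 = ∑ i, (p i - y i) ^ 2}
      = Fintype.card F ^ d := by
  have hv : (fun i => 2 * (y i - z i)) ≠ 0 := by
    obtain ⟨j, hj⟩ := Function.ne_iff.mp hyz
    exact Function.ne_iff.mpr ⟨j, mul_ne_zero h2 (sub_ne_zero.mpr hj)⟩
  rw [← card_linear_form_eq _ hv (∑ i, (y i ^ 2 - z i ^ 2))]
  congr 3
  ext p
  have key : ∑ i, (p i - z i) ^ 2 - ∑ i, (p i - y i) ^ 2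
      = ∑ i, p i * (2 * (y i - z i)) - ∑ i, (y i ^ 2 - z i ^ 2) := by
    rw [← sum_sub_distrib, ← sum_sub_distrib]
    exact sum_congr rfl fun i _ => by ring
  rw [← sub_eq_zero, key, sub_eq_zero]

lemma sum_degE {F : Type} [Field F] [Fintype F] [DecidableEq F] {d : ℕ}
    (E : Finset (Fin d → F)) (p : Fin d → F) : ∑ r, degE E p r = #E := by
  simp only [degE, card_filter]
  rw [sum_comm]
  simp

lemma sum_degE_sq {F : Type} [Field F] [Fintype F] [DecidableEq F] {d : ℕ}
    (E : Finset (Fin d → F)) (p : Fin d → F) :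
    ∑ r, degE E p r ^ 2
      = ∑ y ∈ E, ∑ z ∈ E, if ∑ i, (p i - z i) ^ 2 = ∑ i, (p i - y i) ^ 2 then 1 else 0 := by
  simp only [degE, card_filter, sq (∑ _ ∈ E, _), sum_mul_sum]
  rw [sum_comm]
  refine sum_congr rfl fun y _ => ?_
  rw [sum_comm]
  refine sum_congr rfl fun z _ => ?_
  simp [eq_comm]

/-- The second moment of `degE` over all centres and all radii. -/
lemma card_mul_sum_sum_degE_sq {F : Type} [Field F] [Fintype F] [DecidableEq F]
    (h2 : (2 : F) ≠ 0) {d : ℕ} (E : Finset (Fin d → F)) :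
    Fintype.card F * ∑ p : Fin d → F, ∑ r, degE E p r ^ 2 + #E * Fintype.card F ^ d
      = #E * Fintype.card F ^ (d + 1) + #E ^ 2 * Fintype.card F ^ d := by
  have hrow : ∀ y ∈ E, Fintype.card F * ∑ z ∈ E,
        #{p : Fin d → F | ∑ i, (p i - z i) ^ 2 = ∑ i, (p i - y i) ^ 2} + Fintype.card F ^ d
      = Fintype.card F ^ (d + 1) + #E * Fintype.card F ^ d := by
    intro y hy
    rw [← add_sum_erase E _ hy, mul_add, mul_sum,
      sum_congr rfl fun z hz => card_equidistant h2 (ne_of_mem_erase hz).symm,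
      sum_const, smul_eq_mul, ← card_erase_add_one hy]
    simp only [filter_true, card_univ, Fintype.card_fun, Fintype.card_fin]
    ring
  have hswap : ∑ p : Fin d → F, ∑ r, degE E p r ^ 2 = ∑ y ∈ E, ∑ z ∈ E,
      #{p : Fin d → F | ∑ i, (p i - z i) ^ 2 = ∑ i, (p i - y i) ^ 2} := by
    simp only [sum_degE_sq, card_filter]
    rw [sum_comm]
    exact sum_congr rfl fun y _ => sum_comm
  have hsum := sum_congr (rfl : E = E) hrow
  rw [sum_add_distrib, ← mul_sum, ← hswap] at hsum
  simp only [sum_const, smul_eq_mul] at hsum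
  rw [hsum]
  ring

/-- The variance of `degE` over all centres and all radii. -/
lemma sum_sum_degE_sub_sq {F : Type} [Field F] [Fintype F] [DecidableEq F]
    (h2 : (2 : F) ≠ 0) {d : ℕ} (E : Finset (Fin d → F)) :
    (Fintype.card F : ℝ) * ∑ r, ∑ p : Fin d → F, ((degE E p r : ℝ) - #E / Fintype.card F) ^ 2
      = (Fintype.card F - 1) * #E * (Fintype.card F : ℝ) ^ d := by
  have hq : (Fintype.card F : ℝ) ≠ 0 := by exact_mod_cast Fintype.card_ne_zero
  have hsecond : (Fintype.card F : ℝ) * ∑ p : Fin d → F, ∑ r, (degE E p r : ℝ) ^ 2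
      + #E * (Fintype.card F : ℝ) ^ d
      = #E * (Fintype.card F : ℝ) ^ (d + 1) + (#E : ℝ) ^ 2 * (Fintype.card F : ℝ) ^ d := by
    exact_mod_cast card_mul_sum_sum_degE_sq h2 E
  have hfirst : ∀ p : Fin d → F, ∑ r, (degE E p r : ℝ) = #E := fun p => by
    exact_mod_cast sum_degE E p
  have hexp : ∀ p : Fin d → F, ∑ r, ((degE E p r : ℝ) - #E / Fintype.card F) ^ 2
      = ∑ r, (degE E p r : ℝ) ^ 2 - (#E : ℝ) ^ 2 / Fintype.card F := by
    intro p
    simp only [sub_sq, sum_add_distrib, sum_sub_distrib, ← sum_mul, ← mul_sum, hfirst,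
      sum_const, card_univ, nsmul_eq_mul]
    field_simp
    ring
  rw [sum_comm, sum_congr rfl fun p _ => hexp p, sum_sub_distrib, sum_const, card_univ,
    Fintype.card_fun, Fintype.card_fin, nsmul_eq_mul, Nat.cast_pow, mul_sub]
  have hcancel : (Fintype.card F : ℝ) * ((Fintype.card F : ℝ) ^ d * ((#E : ℝ) ^ 2 / Fintype.card F))
      = (#E : ℝ) ^ 2 * (Fintype.card F : ℝ) ^ d := by
    field_simp
  rw [hcancel]
  linear_combination hsecond

/-- A function whose mean square deviation from `a ≥ 0` is at most `s ^ 2` has mean square at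
most `(a + s) ^ 2`. -/
lemma sum_sq_le_of_sum_sub_sq_le {ι : Type*} (t : Finset ι) (g : ι → ℝ) {a s : ℝ} (ha : 0 ≤ a)
    (hs : 0 < s) (h : ∑ i ∈ t, (g i - a) ^ 2 ≤ #t * s ^ 2) :
    ∑ i ∈ t, g i ^ 2 ≤ #t * (a + s) ^ 2 := by
  have hpt : ∀ i ∈ t, g i ^ 2 ≤ (1 + a / s) * (g i - a) ^ 2 + (a * s + a ^ 2) := by
    intro i _
    have hsq : 0 ≤ a / s * (g i - a - s) ^ 2 := by positivity
    have hexp : (1 + a / s) * (g i - a) ^ 2 + (a * s + a ^ 2)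
        = g i ^ 2 + a / s * (g i - a - s) ^ 2 := by
      field_simp
      ring
    linarith
  calc ∑ i ∈ t, g i ^ 2
      ≤ (1 + a / s) * ∑ i ∈ t, (g i - a) ^ 2 + #t * (a * s + a ^ 2) := by
        refine (sum_le_sum hpt).trans_eq ?_
        rw [sum_add_distrib, ← mul_sum, sum_const, nsmul_eq_mul]
    _ ≤ (1 + a / s) * (#t * s ^ 2) + #t * (a * s + a ^ 2) := by gcongr
    _ = #t * (a + s) ^ 2 := by
        field_simp
        ring

/-- `f(E) ≤ (q − 1)|E|((q^{d−1} + q^{(d−1)/2})|E|/q^d + 2q^{(d−1)/2})²`. -/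
theorem fE_upper_bound (F : Type) [Field F] [Fintype F] [DecidableEq F]
    (hq : Odd (Fintype.card F)) (d : ℕ) (hd : 2 ≤ d)
    (E : Finset (Fin d → F)) :
    (fE E : ℝ) ≤ ((Fintype.card F : ℝ) - 1) * (E.card : ℝ) *
      (((Fintype.card F : ℝ) ^ (d - 1) + (Fintype.card F : ℝ) ^ (((d : ℝ) - 1) / 2)) *
          (E.card : ℝ) / (Fintype.card F : ℝ) ^ d +
        2 * (Fintype.card F : ℝ) ^ (((d : ℝ) - 1) / 2)) ^ 2 := by
  have h2 : (2 : F) ≠ 0 := by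
    refine Ring.two_ne_zero fun h => ?_
    exact (Nat.not_even_iff_odd.mpr hq) (Nat.even_iff.mpr (FiniteField.even_card_iff_char_two.mp h))
  have hvar := sum_sum_degE_sub_sq h2 E
  set q : ℝ := (Fintype.card F : ℝ) with hqdef
  have hq0 : 0 < q := by
    rw [hqdef]
    exact_mod_cast Fintype.card_pos
  have hq1 : 1 ≤ q := by
    rw [hqdef]
    exact_mod_cast Nat.one_le_iff_ne_zero.mpr Fintype.card_ne_zero
  set s : ℝ := q ^ (((d : ℝ) - 1) / 2) with hsdef
  have hs : 0 < s := Real.rpow_pos_of_pos hq0 _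
  have hs2 : q * s ^ 2 = q ^ d := by
    rw [hsdef, ← Real.rpow_mul_natCast hq0.le, ← Real.rpow_natCast q d]
    nth_rewrite 1 [← Real.rpow_one q]
    rw [← Real.rpow_add hq0]
    congr 1
    push_cast
    ring
  have hpow : q ^ d = q * q ^ (d - 1) := by
    rw [← pow_succ', Nat.sub_add_cancel (by omega)]
  have hcard : (#((univ.filter fun r : F => r ≠ 0) ×ˢ E) : ℝ) = (q - 1) * #E := by
    rw [card_product, filter_ne', card_erase_of_mem (mem_univ _), card_univ, Nat.cast_mul,
      Nat.cast_sub Fintype.card_pos, Nat.cast_one]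
  have hdev : ∑ x ∈ (univ.filter fun r : F => r ≠ 0) ×ˢ E, ((degE E x.2 x.1 : ℝ) - #E / q) ^ 2
      ≤ #((univ.filter fun r : F => r ≠ 0) ×ˢ E) * s ^ 2 := by
    calc _ ≤ ∑ x ∈ (univ : Finset F) ×ˢ (univ : Finset (Fin d → F)),
            ((degE E x.2 x.1 : ℝ) - #E / q) ^ 2 :=
          sum_le_sum_of_subset_of_nonneg
            (product_subset_product (filter_subset _ _) (subset_univ _))
            fun _ _ _ => sq_nonneg _
      _ = (q - 1) * #E * s ^ 2 := by
          rw [sum_product]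
          refine mul_left_cancel₀ hq0.ne' ?_
          rw [hvar, ← hs2]
          ring
      _ = _ := by rw [hcard]
  have hmain := sum_sq_le_of_sum_sub_sq_le _ _ (by positivity) hs hdev
  rw [sum_product, hcard] at hmain
  have hbase : (#E : ℝ) / q ≤ (q ^ (d - 1) + s) * #E / q ^ d := by
    rw [hpow, div_le_div_iff₀ hq0 (by positivity)]
    have : 0 ≤ s * #E * q := by positivity
    linarith
  have hN : 0 ≤ (q - 1) * #E := mul_nonneg (by linarith) (by positivity)
  calc (fE E : ℝ) ≤ (q - 1) * #E * (#E / q + s) ^ 2 := by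
        simpa only [fE, Nat.cast_sum, Nat.cast_pow] using hmain
    _ ≤ _ := by
        gcongr
        linarith
end

section
/- Let q be an odd prime power, d ≥ 2, and let E ⊆ F_q^d be a set with |E| ≥ 2 and no null pairs. Then the number of distinct nonzero distances determined by E satisfies |Δ(E) ∩ F_q*| ≥ (|E| − 1)/(2|E|/q + 2q^{(d−1)/2}). -/
open Finset

/-- The distance set `Δ(E) = {‖x − y‖ : x, y ∈ E} ⊆ F_q`, where
`‖x − y‖ = ∑ i, (x i − y i)²`. -/
def distSet {F : Type} [Field F] [DecidableEq F] {d : ℕ}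
    (E : Finset (Fin d → F)) : Finset F :=
  (E ×ˢ E).image (fun p => ∑ i, (p.1 i - p.2 i) ^ 2)

/-- The sum of the squared fibre sizes of a map counts the pairs of points with equal image. -/
theorem sum_card_fiber_sq {α β : Type*} [DecidableEq β] (s : Finset α) (t : Finset β)
    (h : α → β) (hst : ∀ x ∈ s, h x ∈ t) :
    ∑ b ∈ t, ((s.filter fun x => h x = b).card : ℝ) ^ 2 =
      ∑ x ∈ s, ∑ y ∈ s, if h x = h y then (1 : ℝ) else 0 := by
  rw [← Finset.sum_fiberwise_of_maps_to hst]
  refine Finset.sum_congr rfl fun b _ => ?_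
  have : ∀ x ∈ s.filter (fun x => h x = b),
      (∑ y ∈ s, if h x = h y then (1 : ℝ) else 0) = (s.filter fun x => h x = b).card := by
    intro x hx
    rw [← (Finset.mem_filter.mp hx).2]
    simp [eq_comm]
  rw [Finset.sum_congr rfl this, Finset.sum_const, nsmul_eq_mul, sq]

/-- The fibre sizes of a map add up to the size of its domain. -/
theorem sum_card_fiber {α β : Type*} [DecidableEq β] (s : Finset α) (t : Finset β)
    (h : α → β) (hst : ∀ x ∈ s, h x ∈ t) :
    ∑ b ∈ t, ((s.filter fun x => h x = b).card : ℝ) = s.card := by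
  rw [Finset.card_eq_sum_card_fiberwise hst]
  push_cast
  rfl

/-- Cauchy–Schwarz along a map whose fibres have at most `n` elements. -/
theorem sq_sum_comp_le {α β : Type*} [Fintype β] [DecidableEq β] (s : Finset α) (g : α → β)
    (f : β → ℝ) (n : ℕ) (hg : ∀ b, (s.filter fun x => g x = b).card ≤ n) :
    (∑ x ∈ s, f (g x)) ^ 2 ≤ s.card * (n * ∑ b, f b ^ 2) := by
  refine sq_sum_le_card_mul_sum_sq.trans (mul_le_mul_of_nonneg_left ?_ (Nat.cast_nonneg _))
  rw [← Finset.sum_fiberwise s g, Finset.mul_sum]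
  refine Finset.sum_le_sum fun b _ => ?_
  have : ∀ x ∈ s.filter (fun x => g x = b), f (g x) ^ 2 = f b ^ 2 := fun x hx => by
    rw [(Finset.mem_filter.mp hx).2]
  rw [Finset.sum_congr rfl this, Finset.sum_const, nsmul_eq_mul]
  exact mul_le_mul_of_nonneg_right (by exact_mod_cast hg b) (sq_nonneg _)

section Hyperplanes

variable {F : Type} [Field F] [Fintype F] [DecidableEq F] {d : ℕ}

theorem card_dotProduct_eq_zero {v : Fin d → F} (hv : v ≠ 0) :
    ((Finset.univ.filter fun a : Fin d → F => a ⬝ᵥ v = 0).card : ℝ) =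
      (Fintype.card F : ℝ) ^ d / Fintype.card F := by
  obtain ⟨i, hi⟩ := Function.ne_iff.mp hv
  have hq : (Fintype.card F : ℝ) ≠ 0 := by simp
  have hfib : ∀ b ∈ (Finset.univ : Finset F),
      (Finset.univ.filter fun a : Fin d → F => a ⬝ᵥ v = b).card =
        (Finset.univ.filter fun a : Fin d → F => a ⬝ᵥ v = 0).card := by
    intro b _
    have hw : Pi.single i (b / v i) ⬝ᵥ v = b := by
      rw [single_dotProduct]
      exact div_mul_cancel₀ _ hi
    refine Finset.card_bij' (fun a _ => a - Pi.single i (b / v i))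
      (fun a _ => a + Pi.single i (b / v i)) ?_ ?_ ?_ ?_ <;>
      simp +contextual [sub_dotProduct, add_dotProduct, hw, -single_dotProduct]
  have := Finset.card_eq_sum_card_fiberwise (s := (Finset.univ : Finset (Fin d → F)))
    (t := (Finset.univ : Finset F)) (f := fun a => a ⬝ᵥ v) (fun _ _ => Finset.mem_univ _)
  rw [Finset.sum_congr rfl hfib, Finset.sum_const, Finset.card_univ, Finset.card_univ,
    Fintype.card_fun, Fintype.card_fin, smul_eq_mul] at this
  rw [eq_div_iff hq, mul_comm]
  exact_mod_cast this.symm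

/-- The variance of the number of points of `E` on the hyperplanes `a ⬝ᵥ x = b`. -/
theorem sum_sq_card_hyperplane_sub (E : Finset (Fin d → F)) :
    ∑ p : (Fin d → F) × F, (((E.filter fun x => p.1 ⬝ᵥ x = p.2).card : ℝ) -
      E.card / Fintype.card F) ^ 2 =
      E.card * ((Fintype.card F : ℝ) ^ d - (Fintype.card F : ℝ) ^ d / Fintype.card F) := by
  have hq : (Fintype.card F : ℝ) ≠ 0 := by simp
  have hrow : ∀ a : Fin d → F, ∑ b : F, (((E.filter fun x => a ⬝ᵥ x = b).card : ℝ) -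
      E.card / Fintype.card F) ^ 2 =
      (∑ x ∈ E, ∑ y ∈ E, if a ⬝ᵥ x = a ⬝ᵥ y then (1 : ℝ) else 0) -
        (E.card : ℝ) ^ 2 / Fintype.card F := by
    intro a
    have h1 := sum_card_fiber_sq E Finset.univ (fun x => a ⬝ᵥ x) (fun _ _ => Finset.mem_univ _)
    have h2 := sum_card_fiber E Finset.univ (fun x => a ⬝ᵥ x) (fun _ _ => Finset.mem_univ _)
    simp only [sub_sq, Finset.sum_add_distrib, Finset.sum_sub_distrib]
    rw [h1, ← Finset.sum_mul, ← Finset.mul_sum, h2, Finset.sum_const, Finset.card_univ,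
      nsmul_eq_mul]
    field_simp
    ring
  have hcol : ∀ x ∈ E, ∀ y ∈ E,
      (∑ a : Fin d → F, if a ⬝ᵥ x = a ⬝ᵥ y then (1 : ℝ) else 0) =
        (Fintype.card F : ℝ) ^ d / Fintype.card F + if x = y then
          (Fintype.card F : ℝ) ^ d - (Fintype.card F : ℝ) ^ d / Fintype.card F else 0 := by
    intro x _ y _
    split_ifs with hxy
    · simp [hxy]
    · rw [← card_dotProduct_eq_zero (sub_ne_zero.mpr hxy)]
      simp [dotProduct_sub, sub_eq_zero]
  rw [Fintype.sum_prod_type, Finset.sum_congr rfl fun a _ => hrow a, Finset.sum_sub_distrib,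
    Finset.sum_comm, Finset.sum_congr rfl fun x _ => Finset.sum_comm,
    Finset.sum_congr rfl fun x hx => Finset.sum_congr rfl fun y hy => hcol x hx y hy]
  simp [Finset.sum_add_distrib]
  field_simp
  ring

end Hyperplanes

section Bisectors

variable {F : Type} [Field F] {d : ℕ}

theorem sum_sub_sq_eq (x y : Fin d → F) :
    ∑ i, (x i - y i) ^ 2 = x ⬝ᵥ x - 2 * (x ⬝ᵥ y) + y ⬝ᵥ y := by
  simp only [dotProduct, Finset.mul_sum, ← Finset.sum_sub_distrib, ← Finset.sum_add_distrib]
  exact Finset.sum_congr rfl fun i _ => by ring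

/-- Coefficients `(a, b)` of the equation `a ⬝ᵥ x = b` of the bisector of `y` and `z`, scaled by
the unit `c`, where `t = ((y, z), c)`. -/
def bisector (t : ((Fin d → F) × (Fin d → F)) × Fˣ) : (Fin d → F) × F :=
  ((t.2 : F) • (2 : F) • (t.1.2 - t.1.1), t.2 * (t.1.2 ⬝ᵥ t.1.2 - t.1.1 ⬝ᵥ t.1.1))

theorem bisector_dotProduct_iff (t : ((Fin d → F) × (Fin d → F)) × Fˣ) (x : Fin d → F) :
    (bisector t).1 ⬝ᵥ x = (bisector t).2 ↔
      ∑ i, (x i - t.1.1 i) ^ 2 = ∑ i, (x i - t.1.2 i) ^ 2 := by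
  obtain ⟨⟨y, z⟩, c⟩ := t
  simp only [bisector, sum_sub_sq_eq, smul_dotProduct, sub_dotProduct, smul_eq_mul]
  rw [mul_right_inj' c.ne_zero, dotProduct_comm z x, dotProduct_comm y x]
  constructor <;> intro h <;> linear_combination h

/-- A hyperplane is the bisector of at most one pair with a given first point. -/
theorem bisector_inj (h2 : (2 : F) ≠ 0) {y z z' : Fin d → F} {c c' : Fˣ}
    (hyz : ∑ i, (y i - z i) ^ 2 ≠ 0)
    (h : bisector ((y, z), c) = bisector ((y, z'), c')) : z = z' ∧ c = c' := by
  obtain ⟨ha, hb⟩ := Prod.mk.inj h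
  simp only at ha hb
  set v := z - y with hv
  have hz : z = y + v := by simp [hv]
  set v' := z' - y with hv'
  have hz' : z' = y + v' := by simp [hv']
  have hvv : v ⬝ᵥ v ≠ 0 := by
    rw [sum_sub_sq_eq, hz] at hyz
    simp only [dotProduct_add, add_dotProduct, dotProduct_comm v y] at hyz
    intro h0
    exact hyz (by linear_combination h0)
  have hv'v : v' = ((c'⁻¹ * c : Fˣ) : F) • v := by
    rw [smul_comm, smul_comm (c' : F)] at ha
    have := smul_right_injective _ h2 ha
    rw [Units.val_mul, mul_smul, this, smul_smul]
    simp
  set m : Fˣ := c'⁻¹ * c with hm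
  have hc : (c : F) = c' * m := by simp [hm]
  rw [hz', hz, hv'v, hc] at hb
  simp only [dotProduct_add, add_dotProduct, dotProduct_comm v y, dotProduct_smul,
    smul_dotProduct, smul_eq_mul] at hb
  have hne : (c' : F) * m * (v ⬝ᵥ v) ≠ 0 := by simp [hvv]
  have hm1 : (m : F) = 1 := by
    have h0 : ((c' : F) * m * (v ⬝ᵥ v)) * (m - 1) = 0 := by linear_combination -hb
    exact sub_eq_zero.mp ((mul_eq_zero.mp h0).resolve_left hne)
  refine ⟨?_, ?_⟩
  · rw [hz', hz, hv'v, hm1, one_smul]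
  · ext
    rw [hc, hm1, mul_one]

/-- Bound for the number of incidences between `E` and the bisectors of its pairs of points. -/
theorem sum_card_bisector_le [Fintype F] [DecidableEq F] (h2 : (2 : F) ≠ 0) (E : Finset (Fin d → F))
    (hnull : ∀ x ∈ E, ∀ y ∈ E, x ≠ y → ∑ i, (x i - y i) ^ 2 ≠ 0)
    {Q : ℝ} (hQ : 0 ≤ Q) (hQd : Q ^ 2 * Fintype.card F = (Fintype.card F : ℝ) ^ d) :
    ∑ p ∈ E.offDiag, ((E.filter fun x =>
      ∑ i, (x i - p.1 i) ^ 2 = ∑ i, (x i - p.2 i) ^ 2).card : ℝ) ≤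
      (E.card : ℝ) ^ 2 * (E.card - 1) / Fintype.card F + (E.card : ℝ) ^ 2 * Q := by
  set q : ℝ := (Fintype.card F : ℝ) with hq
  set n : ℝ := (E.card : ℝ) with hn
  set S := ∑ p ∈ E.offDiag, ((E.filter fun x =>
      ∑ i, (x i - p.1 i) ^ 2 = ∑ i, (x i - p.2 i) ^ 2).card : ℝ) with hS
  have hq1 : 1 < q := by
    rw [hq]; exact_mod_cast Fintype.one_lt_card
  have hn0 : 0 ≤ n := Nat.cast_nonneg _
  have hoff : (E.offDiag.card : ℝ) = n * (n - 1) := by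
    rw [Finset.offDiag_card, Nat.cast_sub (Nat.le_mul_self _)]
    push_cast
    ring
  have hunits : (Fintype.card Fˣ : ℝ) = q - 1 := by
    rw [Fintype.card_units, Nat.cast_sub Fintype.card_pos, Nat.cast_one]
  have hfib : ∀ b, ((E.offDiag ×ˢ (Finset.univ : Finset Fˣ)).filter
      fun t => bisector t = b).card ≤ E.card := by
    intro b
    refine Finset.card_le_card_of_injOn (fun t => t.1.1) ?_ ?_
    · intro t ht
      simp only [Finset.coe_filter, Finset.mem_product, Finset.mem_offDiag, Set.mem_ofPred_eq]
        at ht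
      exact ht.1.1.1
    · rintro ⟨⟨y, z⟩, c⟩ ht ⟨⟨y', z'⟩, c'⟩ ht' hyy
      simp only [Finset.coe_filter, Finset.mem_product, Finset.mem_offDiag, Set.mem_ofPred_eq]
        at ht ht'
      obtain rfl : y = y' := hyy
      obtain ⟨rfl, rfl⟩ := bisector_inj h2 (hnull y ht.1.1.1 z ht.1.1.2.1 ht.1.1.2.2)
        (ht.2.trans ht'.2.symm)
      rfl
  have hcs := sq_sum_comp_le (E.offDiag ×ˢ (Finset.univ : Finset Fˣ)) bisector
    (fun p => ((E.filter fun x => p.1 ⬝ᵥ x = p.2).card : ℝ) - n / q) E.card hfib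
  rw [sum_sq_card_hyperplane_sub] at hcs
  simp only [bisector_dotProduct_iff, Finset.sum_sub_distrib, Finset.sum_const,
    Finset.sum_product, Finset.card_product, Finset.card_univ, nsmul_eq_mul, Nat.cast_mul,
    ← Finset.mul_sum, hunits, hoff, ← hS, ← hq, ← hn, ← hQd] at hcs
  have hdiff : (S - n * (n - 1) * (n / q)) ^ 2 ≤ (n ^ 2 * Q) ^ 2 := by
    have hpos : 0 < (q - 1) ^ 2 := by nlinarith
    refine le_of_mul_le_mul_left ?_ hpos
    have hq0 : q ≠ 0 := by positivity
    have e : Q ^ 2 * q - Q ^ 2 * q / q = Q ^ 2 * (q - 1) := by field_simp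
    rw [e] at hcs
    have : 0 ≤ (q - 1) ^ 2 * Q ^ 2 * n ^ 3 := by positivity
    nlinarith
  have := abs_le_of_sq_le_sq hdiff (by positivity)
  have e : n ^ 2 * (n - 1) / q = n * (n - 1) * (n / q) := by ring
  rw [e]
  linarith [le_of_abs_le this]

end Bisectors

section Distances

variable {F : Type} [Field F] [DecidableEq F] {d : ℕ}

/-- Cauchy–Schwarz: few distances force many isosceles triangles. -/
theorem card_mul_sq_le_card_distSet_mul (E : Finset (Fin d → F))
    (hnull : ∀ x ∈ E, ∀ y ∈ E, x ≠ y → ∑ i, (x i - y i) ^ 2 ≠ 0) :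
    (E.card : ℝ) * ((E.card : ℝ) - 1) ^ 2 ≤
      (((distSet E).filter (fun r => r ≠ 0)).card : ℝ) *
        ((E.card : ℝ) * ((E.card : ℝ) - 1) + ∑ p ∈ E.offDiag, ((E.filter fun x =>
          ∑ i, (x i - p.1 i) ^ 2 = ∑ i, (x i - p.2 i) ^ 2).card : ℝ)) := by
  set D := (distSet E).filter (fun r => r ≠ 0) with hD
  have hpin : ∀ x ∈ E, ((E.card : ℝ) - 1) ^ 2 ≤ D.card *
      (((E.card : ℝ) - 1) + ∑ p ∈ E.offDiag,
        if ∑ i, (x i - p.1 i) ^ 2 = ∑ i, (x i - p.2 i) ^ 2 then (1 : ℝ) else 0) := by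
    intro x hx
    have hmem : ∀ y ∈ E.erase x, ∑ i, (x i - y i) ^ 2 ∈ D := by
      intro y hy
      obtain ⟨hyx, hy⟩ := Finset.mem_erase.mp hy
      exact Finset.mem_filter.mpr ⟨Finset.mem_image.mpr ⟨(x, y), Finset.mk_mem_product hx hy, rfl⟩,
        hnull x hx y hy hyx.symm⟩
    have hcard : ((E.erase x).card : ℝ) = E.card - 1 := by
      rw [Finset.card_erase_of_mem hx, Nat.cast_sub (Finset.card_pos.mpr ⟨x, hx⟩), Nat.cast_one]
    rw [← hcard, ← sum_card_fiber (E.erase x) D _ hmem]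
    refine sq_sum_le_card_mul_sum_sq.trans (mul_le_mul_of_nonneg_left ?_ (Nat.cast_nonneg _))
    rw [sum_card_fiber_sq _ _ _ hmem, sum_card_fiber (E.erase x) D _ hmem,
      ← Finset.sum_product', ← Finset.diag_union_offDiag,
      Finset.sum_union (Finset.disjoint_diag_offDiag _), Finset.sum_diag]
    refine add_le_add (by simp) (Finset.sum_le_sum_of_subset_of_nonneg
      (Finset.offDiag_mono (Finset.erase_subset _ _)) fun _ _ _ => ?_)
    split_ifs <;> norm_num
  have := Finset.sum_le_sum hpin
  rw [Finset.sum_const, nsmul_eq_mul, ← Finset.mul_sum, Finset.sum_add_distrib, Finset.sum_const,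
    nsmul_eq_mul, Finset.sum_comm] at this
  simpa only [Finset.sum_boole] using this

end Distances

/-- If `E ⊆ F_q^d` has `|E| ≥ 2` and no null pairs, then the number of distinct nonzero
distances determined by `E` is at least `(|E| − 1)/(2|E|/q + 2q^{(d−1)/2})`. -/
theorem distSet_nonzero_lower_bound (F : Type) [Field F] [Fintype F] [DecidableEq F]
    (hq : Odd (Fintype.card F)) (d : ℕ) (hd : 2 ≤ d)
    (E : Finset (Fin d → F)) (hE : 2 ≤ E.card)
    (hnull : ∀ x ∈ E, ∀ y ∈ E, x ≠ y → ∑ i, (x i - y i) ^ 2 ≠ 0) :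
    (((distSet E).filter (fun r => r ≠ 0)).card : ℝ) ≥
      ((E.card : ℝ) - 1) /
        (2 * (E.card : ℝ) / (Fintype.card F : ℝ) +
          2 * (Fintype.card F : ℝ) ^ (((d : ℝ) - 1) / 2)) := by
  set q : ℝ := (Fintype.card F : ℝ) with hqdef
  set Q : ℝ := q ^ (((d : ℝ) - 1) / 2) with hQdef
  have hq3 : 3 ≤ q := by
    have h1 : 1 < Fintype.card F := Fintype.one_lt_card
    obtain ⟨m, hm⟩ := hq
    rw [hqdef]
    exact_mod_cast (by omega : 3 ≤ Fintype.card F)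
  have h2 : (2 : F) ≠ 0 := by
    refine Ring.two_ne_zero fun h => ?_
    have := FiniteField.even_card_iff_char_two.mp h
    rw [Nat.odd_iff] at hq
    omega
  have hQd : Q ^ 2 * q = q ^ d := by
    rw [hQdef, ← Real.rpow_natCast, ← Real.rpow_mul (by positivity)]
    nth_rewrite 2 [← Real.rpow_one q]
    rw [← Real.rpow_add (by positivity), ← Real.rpow_natCast]
    congr 1
    push_cast
    ring
  have hQ0 : 0 ≤ Q := by positivity
  have hQ : 3 / 2 ≤ Q := by
    have h3 : 3 * q ≤ Q ^ 2 * q := by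
      rw [hQd]
      calc 3 * q ≤ q ^ 2 := by nlinarith
        _ ≤ q ^ d := pow_le_pow_right₀ (by linarith) hd
    have h4 : 3 ≤ Q ^ 2 := le_of_mul_le_mul_right h3 (by linarith)
    nlinarith
  have hmain := card_mul_sq_le_card_distSet_mul E hnull
  have hbis := sum_card_bisector_le h2 E hnull hQ0 hQd
  have hk : (1 : ℝ) ≤ ((distSet E).filter (fun r => r ≠ 0)).card := by
    obtain ⟨x, hx, y, hy, hxy⟩ := Finset.one_lt_card.mp hE
    exact_mod_cast Finset.card_pos.mpr ⟨_, Finset.mem_filter.mpr ⟨Finset.mem_image.mpr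
      ⟨(x, y), Finset.mk_mem_product hx hy, rfl⟩, hnull x hx y hy hxy⟩⟩
  set k : ℝ := (((distSet E).filter (fun r => r ≠ 0)).card : ℝ)
  have hn2 : (2 : ℝ) ≤ E.card := by exact_mod_cast hE
  have hsmall : (E.card : ℝ) ≤ 3 ∨ (4 : ℝ) ≤ E.card := by
    rcases Nat.lt_or_ge 3 E.card with h | h
    · exact Or.inr (by exact_mod_cast h)
    · exact Or.inl (by exact_mod_cast h)
  set n : ℝ := (E.card : ℝ)
  have hu : 0 ≤ n / q := by positivity
  rw [mul_div_assoc, ge_iff_le, div_le_iff₀ (by positivity)]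
  rcases hsmall with h | h
  · nlinarith
  · have e : n ^ 2 * (n - 1) / q = n * ((n / q) * (n - 1)) := by ring
    rw [e] at hbis
    set u := n / q
    have hk0 : 0 ≤ k := by linarith
    have h5 : n * (n - 1) ^ 2 ≤ n * (k * ((n - 1) + u * (n - 1) + n * Q)) :=
      hmain.trans (by
        refine (mul_le_mul_of_nonneg_left (add_le_add_right hbis _) hk0).trans (le_of_eq ?_)
        ring)
    have h6 := le_of_mul_le_mul_left h5 (by linarith)
    have h7 : (n - 1) + u * (n - 1) + n * Q ≤ (n - 1) * (2 * u + 2 * Q) := by nlinarith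
    have h8 := h6.trans (mul_le_mul_of_nonneg_left h7 hk0)
    refine le_of_mul_le_mul_left (a := n - 1) ?_ (by linarith)
    linarith
end
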